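/- arXiv:2103.08802 — 2 statements merged into one kernel-verified Lean document; each statement's English description precedes it below -/
import Mathlib

section
/- Suppose all maps in the parareal network data are linear (each g_j, C_j, F_j and h is a linear map of real vector spaces) and the coarse maps coincide with the shifted subnetwork maps, i.e. F_j = g_{j+1} for every j = 1, …, N−1. Then the parareal network reproduces the original network exactly: f̄(x) = f(x) for all x ∈ X. -/
/-- **Consistency of the parareal neural network.**
Let `N = M + 1 ≥ 1`.  Indices are zero-based: `g j`, `C j`, `F j`, `r j`, `rt j`
denote the paper's `g_{j+1} : X_j → X_{j+1}`, `C_{j+1} : X → X_j`,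
`F_{j+1} : X_{j+1} → X_{j+2}`, `r_{j+1}` and `r̃_{j+1}`.
All maps are linear, and the coarse maps coincide with the shifted subnetwork
maps (`F_j = g_{j+1}`, i.e. `F j = g (j+1)` zero-based, for `j < M`).
The parareal forward pass: residuals `r j = g j (C j x) - C (j+1) x` for
`j < M` and `r M = 0` (the paper's `r_N = 0`); corrected residuals
`rt 0 = r 0`, `rt (j+1) = r (j+1) + F j (rt j)`; output
`f̄(x) = h (g M (C M x) + rt M)` (the paper's `h (y_N + r̃_N)`).
The original network is `f(x) = h (u (M+1))` where `u` is the sequential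
propagation `u 0 = C 0 x`, `u (j+1) = g j (u j)`.
Conclusion: `f̄(x) = f(x)` for all `x ∈ X`. -/
theorem parareal_consistency
    (M : ℕ) (X Y : Type*) [AddCommGroup X] [Module ℝ X]
    [AddCommGroup Y] [Module ℝ Y]
    (Xs : ℕ → Type*) [∀ j, AddCommGroup (Xs j)] [∀ j, Module ℝ (Xs j)]
    (g : ∀ j, Xs j →ₗ[ℝ] Xs (j + 1))
    (C : ∀ j, X →ₗ[ℝ] Xs j)
    (F : ∀ j, Xs (j + 1) →ₗ[ℝ] Xs (j + 2))
    (h : Xs (M + 1) →ₗ[ℝ] Y)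
    (hF : ∀ j, j < M → F j = g (j + 1))
    (x : X)
    (r : ∀ j, Xs (j + 1))
    (hr : ∀ j, j < M → r j = g j (C j x) - C (j + 1) x)
    (hrM : r M = 0)
    (rt : ∀ j, Xs (j + 1))
    (hrt0 : rt 0 = r 0)
    (hrtS : ∀ j, j < M → rt (j + 1) = r (j + 1) + F j (rt j))
    (u : ∀ j, Xs j)
    (hu0 : u 0 = C 0 x)
    (huS : ∀ j, j < M + 1 → u (j + 1) = g j (u j)) :
    h (g M (C M x) + rt M) = h (u (M + 1)) := by
  have key : ∀ j, j ≤ M → g j (C j x) + rt j = u (j + 1) + r j := by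
    intro j
    induction j with
    | zero =>
      intro _
      rw [huS 0 M.succ_pos, hu0, hrt0]
    | succ j ih =>
      intro hj
      have hlt : j < M := hj
      have hrt : rt j = u (j + 1) - C (j + 1) x := by
        have hsum := ih hlt.le
        rw [hr j hlt] at hsum
        rw [eq_sub_of_add_eq' hsum]
        abel
      rw [hrtS j hlt, hF j hlt, hrt, map_sub, huS (j + 1) (by omega)]
      abel
  rw [key M le_rfl, hrM, add_zero]
end

section
/- Suppose all maps in the parareal network data are linear (each g_j, C_j, F_j and h is a linear map of real vector spaces) and F_j = g_{j+1} for every j = 1, …, N−1. Then for every x ∈ X and every j = 1, …, N−1, the corrected residual equals the discrepancy between exact sequential propagation and the preprocessed input of the next subnetwork: r̃_j = (g_j ∘ g_{j−1} ∘ ⋯ ∘ g_1 ∘ C_1)(x) − C_{j+1}(x). -/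
/-- **Corrected residuals equal the sequential-propagation discrepancy.**
Let `N = M + 1 ≥ 1`.  Indices are zero-based: `g j`, `C j`, `F j`, `r j`, `rt j`
denote the paper's `g_{j+1} : X_j → X_{j+1}`, `C_{j+1} : X → X_j`,
`F_{j+1} : X_{j+1} → X_{j+2}`, `r_{j+1}` and `r̃_{j+1}`.
All maps are linear and `F_j = g_{j+1}` for `j = 1, …, N-1` (zero-based:
`F j = g (j+1)` for `j < M`).  With the parareal forward pass as in the paper
(`r j = g j (C j x) - C (j+1) x` for `j < M`, `r M = 0`, `rt 0 = r 0`,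
`rt (j+1) = r (j+1) + F j (rt j)`) and `u` the sequential propagation
(`u 0 = C 0 x`, `u (j+1) = g j (u j)`), the conclusion states, for every
`j = 1, …, N-1` (zero-based `rt j` with `j < M`):
`r̃_j = (g_j ∘ ⋯ ∘ g_1 ∘ C_1)(x) - C_{j+1}(x)`. -/
theorem parareal_corrected_residual_formula
    (M : ℕ) (X Y : Type*) [AddCommGroup X] [Module ℝ X]
    [AddCommGroup Y] [Module ℝ Y]
    (Xs : ℕ → Type*) [∀ j, AddCommGroup (Xs j)] [∀ j, Module ℝ (Xs j)]
    (g : ∀ j, Xs j →ₗ[ℝ] Xs (j + 1))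
    (C : ∀ j, X →ₗ[ℝ] Xs j)
    (F : ∀ j, Xs (j + 1) →ₗ[ℝ] Xs (j + 2))
    (h : Xs (M + 1) →ₗ[ℝ] Y)
    (hF : ∀ j, j < M → F j = g (j + 1))
    (x : X)
    (r : ∀ j, Xs (j + 1))
    (hr : ∀ j, j < M → r j = g j (C j x) - C (j + 1) x)
    (hrM : r M = 0)
    (rt : ∀ j, Xs (j + 1))
    (hrt0 : rt 0 = r 0)
    (hrtS : ∀ j, j < M → rt (j + 1) = r (j + 1) + F j (rt j))
    (u : ∀ j, Xs j)
    (hu0 : u 0 = C 0 x)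
    (huS : ∀ j, u (j + 1) = g j (u j)) :
    ∀ j, j < M → rt j = u (j + 1) - C (j + 1) x := by
  intro j
  induction j with
  | zero =>
    intro hj
    rw [hrt0, hr 0 hj, huS 0, hu0]
  | succ k ih =>
    intro hj
    have hk : k < M := Nat.lt_of_succ_lt hj
    rw [hrtS k hk, hr (k + 1) hj, hF k hk, ih hk, map_sub, huS (k + 1)]
    abel
end
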